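/- arXiv:2210.04319 — 4 statements merged into one kernel-verified Lean document; each statement's English description precedes it below -/
import Mathlib

section
/- Let d ≥ 1 and η > 0, and let (a_t), (b_t) be real sequences and (C_t) a sequence with C_t ∈ (0, d) and η·C_t ≤ 10⁻⁹ for all t. Assume a₀, b₀ > 0 with a₀ < 0.82·b₀, let T be the first index with a_T ≤ 0 (assumed finite), and suppose that for all t < T: a_{t+1} ≤ a_t − η C_t b_t and b_{t+1} ≥ b_t − 1.0000001·η C_t a_t. Then Σ_{s<T} η C_s a_s ≤ 0.49·b₀; consequently b_t ≥ 0.5·b₀ for all t ≤ T, and a_t ≤ a₀ − 0.5·b₀·η·Σ_{s<t} C_s for all t ≤ T. -/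
/-- One step of the coupled recursion with coupling constant `κ` nearly preserves
`B ^ 2 - κ * A ^ 2`, with a loss controlled by the decrease of `A`. -/
theorem sq_sub_mul_sq_step {κ h A A' B β ε : ℝ} (hκ : 0 ≤ κ) (hh : 0 ≤ h)
    (hε : κ * h ≤ ε) (hB : 0 ≤ B) (hBβ : B ≤ β) (hA' : 0 ≤ A')
    (hstep : A' ≤ A - h * B) :
    B ^ 2 - κ * A ^ 2 - ε * β * (A - A') ≤ (B - κ * h * A) ^ 2 - κ * A' ^ 2 := by
  have hsq : A' ^ 2 ≤ (A - h * B) ^ 2 := by gcongr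
  have hloss : κ * h * (B * (h * B)) ≤ ε * (β * (A - A')) := by
    have : h * B ≤ A - A' := by linarith
    gcongr
    · exact le_trans (by positivity) hε
    · exact hB.trans hBβ
  have hmul := mul_le_mul_of_nonneg_left hsq hκ
  nlinarith [sq_nonneg (κ * h * A)]


/-- Coupled descent/ascent sequences: if `a₀, b₀ > 0` with
`a₀ < 0.82·b₀`, `C_t ∈ (0, d)` with `η·C_t ≤ 10⁻⁹`, `T` is the first index with
`a_T ≤ 0`, and for all `t < T` we have `a_{t+1} ≤ a_t − η C_t b_t` and
`b_{t+1} ≥ b_t − 1.0000001·η C_t a_t`, then `Σ_{s<T} η C_s a_s ≤ 0.49·b₀`;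
consequently `b_t ≥ 0.5·b₀` for all `t ≤ T` and
`a_t ≤ a₀ − 0.5·b₀·η·Σ_{s<t} C_s` for all `t ≤ T`. -/
theorem stmt6 (d : ℕ) (hd : 1 ≤ d) (η : ℝ) (hη : 0 < η)
    (a b Cs : ℕ → ℝ)
    (hCpos : ∀ t, 0 < Cs t) (hCd : ∀ t, Cs t < (d : ℝ))
    (hsmall : ∀ t, η * Cs t ≤ 1e-9)
    (ha0 : 0 < a 0) (hb0 : 0 < b 0) (hab : a 0 < 0.82 * b 0)
    (T : ℕ) (hT : a T ≤ 0) (hTfirst : ∀ s, s < T → 0 < a s)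
    (hstepa : ∀ t, t < T → a (t + 1) ≤ a t - η * Cs t * b t)
    (hstepb : ∀ t, t < T → b t - 1.0000001 * η * Cs t * a t ≤ b (t + 1)) :
    (∑ s ∈ Finset.range T, η * Cs s * a s) ≤ 0.49 * b 0 ∧
      (∀ t ≤ T, 0.5 * b 0 ≤ b t) ∧
      (∀ t ≤ T, a t ≤ a 0 - 0.5 * b 0 * η * ∑ s ∈ Finset.range t, Cs s) := by
  set β := b 0 with hβ
  set S : ℕ → ℝ := fun t => ∑ s ∈ Finset.range t, η * Cs s * a s with hS
  have hSs (t : ℕ) : S (t + 1) = S t + η * Cs t * a t := Finset.sum_range_succ _ _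
  have hS0 : S 0 = 0 := by simp [hS]
  have hh (t : ℕ) : 0 < η * Cs t := mul_pos hη (hCpos t)
  have hbS : ∀ t ≤ T, β - 1.0000001 * S t ≤ b t := by
    intro t
    induction t with
    | zero => intro _; simp [hS0, hβ]
    | succ n ih =>
      intro hn
      have h1 := ih (by lia)
      have h2 := hstepb n (by lia)
      rw [hSs]
      linarith
  have hS_nonneg : ∀ t ≤ T, 0 ≤ S t := fun t ht => Finset.sum_nonneg fun s hs =>
    (mul_pos (hh s) (hTfirst s (by have := Finset.mem_range.1 hs; lia))).le
  have hdrop (x A C : ℝ) (hx0 : 0 < x) (hx : x ≤ 1e-9) (hA : A ≤ 0.82 * β)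
      (hC : 0.57 * β ≤ C) : 0.569 * β ≤ C - 1.0000001 * x * A := by
    have : x * A ≤ 1e-9 * (0.82 * β) := by
      calc x * A ≤ x * (0.82 * β) := by gcongr
        _ ≤ _ := by gcongr
    linarith
  have key : ∀ t < T, a t ≤ 0.82 * β ∧ 0.57 * β ≤ β - 1.0000001 * S t ∧
      β ^ 2 - 1.0000001 * a 0 ^ 2 - 1e-8 * β * (a 0 - a t) ≤
        (β - 1.0000001 * S t) ^ 2 - 1.0000001 * a t ^ 2 := by
    intro t
    induction t with
    | zero =>
      intro _
      rw [hS0]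
      exact ⟨hab.le, by linarith, by linarith⟩
    | succ n ih =>
      intro hn
      obtain ⟨hA, hB, hV⟩ := ih (by lia)
      have hApos := hTfirst (n + 1) hn
      have hSn := hS_nonneg n (by lia)
      have hx := hh n
      have hx' := hsmall n
      have hstep : a (n + 1) ≤ a n - η * Cs n * (β - 1.0000001 * S n) := by
        have h1 := hstepa n (by lia)
        have h2 := mul_le_mul_of_nonneg_left (hbS n (by lia)) hx.le
        linarith
      have hB0 : 0 ≤ β - 1.0000001 * S n := by linarith
      have hloss := sq_sub_mul_sq_step (κ := 1.0000001) (ε := 1e-8) (β := β)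
        (by norm_num) hx.le (by linarith) hB0 (by linarith) hApos.le hstep
      have hSeq : β - 1.0000001 * S (n + 1) =
          β - 1.0000001 * S n - 1.0000001 * (η * Cs n) * a n := by
        rw [hSs]; ring
      rw [hSeq]
      have hlow := hdrop _ _ _ hx hx' hA hB
      have hA1 : a (n + 1) ≤ 0.82 * β := by
        have := mul_nonneg hx.le hB0
        linarith
      have hV1 : β ^ 2 - 1.0000001 * a 0 ^ 2 - 1e-8 * β * (a 0 - a (n + 1)) ≤
          (β - 1.0000001 * S n - 1.0000001 * (η * Cs n) * a n) ^ 2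
            - 1.0000001 * a (n + 1) ^ 2 := by linarith
      refine ⟨hA1, ?_, hV1⟩
      have ha0sq : a 0 ^ 2 ≤ (0.82 * β) ^ 2 := by gcongr
      have hdiff : β * (a 0 - a (n + 1)) ≤ β * (0.82 * β) := by
        gcongr; linarith
      refine (sq_le_sq₀ (by positivity) (by linarith)).1 ?_
      nlinarith [sq_nonneg (a (n + 1)), sq_nonneg β]
  have hBlow : ∀ t ≤ T, 0.569 * β ≤ β - 1.0000001 * S t := by
    intro t ht
    cases t with
    | zero => rw [hS0]; linarith
    | succ n =>
      obtain ⟨hA, hB, -⟩ := key n (by lia)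
      have := hdrop _ _ _ (hh n) (hsmall n) hA hB
      rw [hSs]
      linarith
  have hblow : ∀ t ≤ T, 0.5 * β ≤ b t := fun t ht => by
    linarith [hBlow t ht, hbS t ht]
  refine ⟨?_, hblow, ?_⟩
  · have := hBlow T le_rfl
    change S T ≤ _
    linarith
  · intro t
    induction t with
    | zero => intro _; simp
    | succ n ih =>
      intro hn
      have h1 := ih (by lia)
      have h2 := hstepa n (by lia)
      have h3 := mul_le_mul_of_nonneg_left (hblow n (by lia)) (hh n).le
      rw [Finset.sum_range_succ]
      linarith
end

section
/- Let d ≥ 1, η > 0, C > 100, and let (a_t), (b_t) be real sequences and (C_t) a sequence with C_t ∈ (0, d) and η·C_t ≤ 10⁻⁹ for all t. Assume a₀, b₀ > 0 with a₀ < b₀/C, let T be the first index with a_T ≤ 0 (assumed finite), and suppose that for all t < T: a_{t+1} ≤ a_t − η C_t b_t and b_{t+1} ≥ b_t − 1.0000001·η C_t a_t. Then Σ_{s<T} η C_s a_s ≤ 10·b₀/C. -/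
/-- Coupled descent/ascent sequences, small-`a₀` case: if
`a₀, b₀ > 0` with `a₀ < b₀/C` for some `C > 100`, `C_t ∈ (0, d)` with
`η·C_t ≤ 10⁻⁹`, `T` is the first index with `a_T ≤ 0`, and for all `t < T`
`a_{t+1} ≤ a_t − η C_t b_t` and `b_{t+1} ≥ b_t − 1.0000001·η C_t a_t`,
then `Σ_{s<T} η C_s a_s ≤ 10·b₀/C`. -/
theorem stmt7 (d : ℕ) (hd : 1 ≤ d) (η C : ℝ) (hη : 0 < η) (hC : 100 < C)
    (a b Cs : ℕ → ℝ)
    (hCpos : ∀ t, 0 < Cs t) (hCd : ∀ t, Cs t < (d : ℝ))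
    (hsmall : ∀ t, η * Cs t ≤ 1e-9)
    (ha0 : 0 < a 0) (hb0 : 0 < b 0) (hab : a 0 < b 0 / C)
    (T : ℕ) (hT : a T ≤ 0) (hTfirst : ∀ s, s < T → 0 < a s)
    (hstepa : ∀ t, t < T → a (t + 1) ≤ a t - η * Cs t * b t)
    (hstepb : ∀ t, t < T → b t - 1.0000001 * η * Cs t * a t ≤ b (t + 1)) :
    (∑ s ∈ Finset.range T, η * Cs s * a s) ≤ 10 * b 0 / C := by
  have hx : ∀ t, 0 < η * Cs t := fun t => mul_pos hη (hCpos t)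
  have hCpos' : 0 < C := by linarith
  have haC : a 0 * C < b 0 := (lt_div_iff₀ hCpos').mp hab
  have ha100 : 100 * a 0 < b 0 := by nlinarith
  have bound_of_scaled : ∀ S u : ℝ, 0 < u → S * b 0 ≤ 2 * a 0 * (a 0 - u) → S ≤ a 0 / 50 := by
    intro S u hu h
    have hau : 0 < a 0 * u := mul_pos ha0 hu
    refine le_of_mul_le_mul_right ?_ hb0
    nlinarith
  have invariant : ∀ t, t < T → a t ≤ a 0 ∧
      (∑ s ∈ Finset.range t, η * Cs s * a s) * b 0 ≤ 2 * a 0 * (a 0 - a t) ∧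
      b 0 - 1.0000001 * (∑ s ∈ Finset.range t, η * Cs s * a s) ≤ b t := by
    intro t
    induction t with
    | zero => intro _; simp
    | succ t ih =>
      intro ht
      have htT : t < T := by omega
      obtain ⟨hat, hSt, hbt⟩ := ih htT
      have hS := bound_of_scaled _ _ (hTfirst t htT) hSt
      have ha := hstepa t htT
      have hb := hstepb t htT
      have hb_half : b 0 / 2 ≤ b t := by norm_num at hbt ⊢; linarith
      have hxb : η * Cs t * (b 0 / 2) ≤ η * Cs t * b t :=
        mul_le_mul_of_nonneg_left hb_half (hx t).le
      have hxb0 : 0 < η * Cs t * b 0 := mul_pos (hx t) hb0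
      rw [Finset.sum_range_succ]
      refine ⟨by linarith, ?_, ?_⟩
      · have h1 : η * Cs t * b 0 * a t ≤ η * Cs t * b 0 * a 0 :=
          mul_le_mul_of_nonneg_left hat hxb0.le
        have h2 : a 0 * (η * Cs t * b 0) ≤ a 0 * (2 * (a t - a (t + 1))) :=
          mul_le_mul_of_nonneg_left (by linarith) ha0.le
        linarith
      · linarith
  have hgoal : a 0 ≤ 10 * b 0 / C := by
    rw [mul_div_assoc]
    linarith
  cases T with
  | zero => linarith
  | succ t =>
    obtain ⟨hat, hSt, -⟩ := invariant t (Nat.lt_succ_self t)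
    have hat_pos := hTfirst t (Nat.lt_succ_self t)
    have hS := bound_of_scaled _ _ hat_pos hSt
    have hlast : η * Cs t * a t ≤ 1e-9 * a 0 :=
      mul_le_mul (hsmall t) hat hat_pos.le (by norm_num)
    rw [Finset.sum_range_succ]
    norm_num at hlast
    linarith
end

section
/- For every g > 0 and every b ∈ ℝ, the function x ↦ x·sigmoid(−g x − b) is nonincreasing on the set {x ∈ ℝ : g x ≥ 2 and g x + b ≥ 0}. -/
/-- The logistic sigmoid function. -/
noncomputable def sigmoid (t : ℝ) : ℝ := 1 / (1 + Real.exp (-t))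

/-- For every `g > 0` and every `b : ℝ`, the function
`x ↦ x * sigmoid (-g*x - b)` is nonincreasing on the set
`{x | g*x ≥ 2 and g*x + b ≥ 0}`. -/
theorem stmt9 (g b : ℝ) (hg : 0 < g) :
    AntitoneOn (fun x : ℝ => x * sigmoid (-(g * x) - b))
      {x : ℝ | 2 ≤ g * x ∧ 0 ≤ g * x + b} := by
  rintro x ⟨hx, hxb⟩ y - hxy
  have hx0 : 0 < x := pos_of_mul_pos_right (by linarith : 0 < g * x) hg.le
  have hE : 1 ≤ Real.exp (g * x + b) := Real.one_le_exp hxb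
  have hsplit : Real.exp (g * y + b) = Real.exp (g * x + b) * Real.exp (g * (y - x)) := by
    rw [← Real.exp_add]
    ring_nf
  have hd : g * (y - x) + 1 ≤ Real.exp (g * (y - x)) := Real.add_one_le_exp _
  have hneg (z : ℝ) : -(-(g * z) - b) = g * z + b := by ring
  simp only [sigmoid, hneg, mul_one_div]
  rw [div_le_div_iff₀ (by positivity) (by positivity), hsplit]
  set E := Real.exp (g * x + b)
  have hslope : 1 + E ≤ g * x * E := by nlinarith
  calc y * (1 + E) = x * (1 + E) + (y - x) * (1 + E) := by ring
    _ ≤ x * (1 + E) + (y - x) * (g * x * E) := by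
      have := sub_nonneg.2 hxy
      gcongr
    _ = x * (1 + E * (g * (y - x) + 1)) := by ring
    _ ≤ x * (1 + E * Real.exp (g * (y - x))) := by gcongr
end

section
/- For every g > 0 and every b ∈ ℝ, the function x ↦ x²·sigmoid(−g x³ − b) is nonincreasing on the set {x > 0 : g x³ ≥ 4/3 and g x³ + b ≥ 0}. -/
/-- Above height zero, `1 + exp` grows at relative rate at least `1/2`. -/
lemma one_add_exp_mul_le {u v : ℝ} (hu : 0 ≤ u) (huv : u ≤ v) :
    (1 + Real.exp u) * (1 + (v - u) / 2) ≤ 1 + Real.exp v := by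
  have h1 : 1 ≤ Real.exp u := Real.one_le_exp hu
  have h2 : Real.exp u * (v - u + 1) ≤ Real.exp v := by
    calc Real.exp u * (v - u + 1) ≤ Real.exp u * Real.exp (v - u) := by
          gcongr
          exact Real.add_one_le_exp _
      _ = Real.exp v := by rw [← Real.exp_add]; congr 1; ring
  nlinarith [mul_nonneg (sub_nonneg.2 h1) (sub_nonneg.2 huv)]

lemma sq_le_sq_mul_one_add_cube_sub {g x y : ℝ} (hx : 0 < x) (hxy : x ≤ y)
    (hgx : 4 / 3 ≤ g * x ^ 3) :
    y ^ 2 ≤ x ^ 2 * (1 + g * (y ^ 3 - x ^ 3) / 2) := by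
  have h3 : 0 ≤ y ^ 3 - x ^ 3 := sub_nonneg.2 (by gcongr)
  have h4 : 0 ≤ (y - x) ^ 2 * (2 * y + x) := by
    have : 0 < y := hx.trans_le hxy
    positivity
  refine le_of_mul_le_mul_left ?_ hx
  nlinarith [mul_le_mul_of_nonneg_right hgx h3]

/-- For every `g > 0` and every `b : ℝ`, the function
`x ↦ x^2 * sigmoid (-g*x^3 - b)` is nonincreasing on
`{x > 0 | g*x^3 ≥ 4/3 and g*x^3 + b ≥ 0}`. -/
theorem stmt10 (g b : ℝ) (hg : 0 < g) :
    AntitoneOn (fun x : ℝ => x ^ 2 * sigmoid (-(g * x ^ 3) - b))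
      {x : ℝ | 0 < x ∧ 4 / 3 ≤ g * x ^ 3 ∧ 0 ≤ g * x ^ 3 + b} := by
  rintro x ⟨hx, hgx, hu⟩ y - hxy
  have hcube : g * x ^ 3 ≤ g * y ^ 3 := by gcongr
  have hexp := one_add_exp_mul_le hu (add_le_add_left hcube b)
  have hsq := sq_le_sq_mul_one_add_cube_sub hx hxy hgx
  have hneg (t : ℝ) : -(-(g * t ^ 3) - b) = g * t ^ 3 + b := by ring
  simp only [sigmoid, hneg, mul_one_div]
  rw [div_le_div_iff₀ (by positivity) (by positivity)]
  calc y ^ 2 * (1 + Real.exp (g * x ^ 3 + b))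
      ≤ x ^ 2 * (1 + g * (y ^ 3 - x ^ 3) / 2) * (1 + Real.exp (g * x ^ 3 + b)) := by gcongr
    _ = x ^ 2 * ((1 + Real.exp (g * x ^ 3 + b)) *
          (1 + (g * y ^ 3 + b - (g * x ^ 3 + b)) / 2)) := by ring
    _ ≤ x ^ 2 * (1 + Real.exp (g * y ^ 3 + b)) := by gcongr
end
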